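/- Let c : (X × Y) × (X × Y) → ℝ be a decomposable cost, c((x, y), (x', y')) = c₁(x, x') + c₂(y, y'), with c₁, c₂ nonnegative and measurable, let μ, ν be probability measures on X × Y, and let 1 ≤ α < ∞. Suppose an optimal coupling γ*_y ∈ Γ(μ_y, ν_y) attaining W_{α,c₂}(μ_y, ν_y) exists. Then W_{α,c}(μ, ν) ≤ W_{α,c₂}(μ_y, ν_y) + ( ∫ W_{α,c₁}(μ_{x|y}(·|y), ν_{x|y}(·|y'))^α dγ*_y(y, y') )^{1/α}, where μ_{x|y} and ν_{x|y} denote the disintegrations (conditional distributions of the first coordinate given the second) of μ and ν. -/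

import Mathlib

open MeasureTheory ProbabilityTheory

/-- A coupling of `μ` and `ν`: a joint measure on the product with the given marginals. -/
def IsCoupling {A B : Type*} [MeasurableSpace A] [MeasurableSpace B]
    (γ : Measure (A × B)) (μ : Measure A) (ν : Measure B) : Prop :=
  γ.map Prod.fst = μ ∧ γ.map Prod.snd = ν

/-- The `α`-Wasserstein distance between `μ` and `ν` with cost function `c`:
`W_{α,c}(μ,ν) = (inf_{γ ∈ Γ(μ,ν)} ∫ c^α dγ)^{1/α}`. -/
noncomputable def Wass {A B : Type*} [MeasurableSpace A] [MeasurableSpace B]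
    (α : ℝ) (c : A × B → ℝ) (μ : Measure A) (ν : Measure B) : ℝ :=
  sInf { r | ∃ γ : Measure (A × B), IsCoupling γ μ ν ∧ r = ∫ z, c z ^ α ∂γ } ^ (1 / α)

/-- The 1-Wasserstein distance between `μ` and `ν` with cost function `c`. -/
noncomputable def W1 {A B : Type*} [MeasurableSpace A] [MeasurableSpace B]
    (c : A × B → ℝ) (μ : Measure A) (ν : Measure B) : ℝ :=
  sInf { r | ∃ γ : Measure (A × B), IsCoupling γ μ ν ∧ r = ∫ z, c z ∂γ }

/-- The risk of classifier `f` under joint distribution `p`, w.r.t. loss `ℓ`. -/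
noncomputable def risk {X Y : Type*} [MeasurableSpace X] [MeasurableSpace Y]
    (ℓ : Y × Y → ℝ) (f : X → Y) (p : Measure (X × Y)) : ℝ :=
  ∫ z, ℓ (f z.1, z.2) ∂p

/-- `f#p` : pushforward of a joint measure `p` under `(x, y) ↦ (f x, y)`. -/
noncomputable def jmap {X Y : Type*} [MeasurableSpace X] [MeasurableSpace Y]
    (f : X → Y) (p : Measure (X × Y)) : Measure (Y × Y) :=
  p.map (fun z => (f z.1, z.2))

instance jmap.instIsFiniteMeasure {X Y : Type*} [MeasurableSpace X] [MeasurableSpace Y]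
    (f : X → Y) (p : Measure (X × Y)) [IsFiniteMeasure p] : IsFiniteMeasure (jmap f p) := by
  unfold jmap; infer_instance

open scoped ENNReal Topology

/-- Inner regularity of a finite measure on continuous images of the Baire space. -/
lemma exists_measurableSet_subset_range_of_lt_measure {Z : Type*} [TopologicalSpace Z] [T2Space Z]
    [FirstCountableTopology Z] [MeasurableSpace Z] [OpensMeasurableSpace Z]
    {ρ : Measure Z} [IsFiniteMeasure ρ] {f : (ℕ → ℕ) → Z} (hf : Continuous f)
    {t : ℝ≥0∞} (ht : t < ρ (Set.range f)) :
    ∃ K ⊆ Set.range f, MeasurableSet K ∧ t ≤ ρ K := by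
  have step : ∀ (T : {T : Set (ℕ → ℕ) // t < ρ (f '' T)}) (k : ℕ),
      ∃ m : ℕ, t < ρ (f '' (T.1 ∩ {x | x k ≤ m})) := by
    rintro ⟨T, hT⟩ k
    have hU : f '' T = ⋃ m : ℕ, f '' (T ∩ {x | x k ≤ m}) := by
      rw [← Set.image_iUnion, ← Set.inter_iUnion]
      congr 1
      ext x
      simpa using fun _ => ⟨x k, le_rfl⟩
    have hmono : Monotone fun m : ℕ => f '' (T ∩ {x | x k ≤ m}) := fun a b hab =>
      Set.image_mono (Set.inter_subset_inter_right _ fun x (hx : x k ≤ a) => hx.trans hab)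
    rw [hU, hmono.measure_iUnion] at hT
    exact lt_iSup_iff.1 hT
  choose m hm using step
  let T : ℕ → {T : Set (ℕ → ℕ) // t < ρ (f '' T)} := fun k =>
    Nat.rec ⟨Set.univ, by simpa using ht⟩ (fun k S => ⟨_, hm S k⟩) k
  have hTs : ∀ k, (T (k + 1)).1 = (T k).1 ∩ {x | x k ≤ m (T k) k} := fun k => rfl
  let n : ℕ → ℕ := fun k => m (T k) k
  have hanti : Antitone fun k => (T k).1 :=
    antitone_nat_of_succ_le fun k => by rw [hTs]; exact Set.inter_subset_left
  have hTle : ∀ k i, i < k → ∀ x ∈ (T k).1, x i ≤ n i := fun k i hik x hx => by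
    have : x ∈ (T (i + 1)).1 := hanti hik hx
    rw [hTs] at this
    exact this.2
  refine ⟨⋂ k, closure (f '' (T k).1), ?_, .iInter fun k => isClosed_closure.measurableSet, ?_⟩
  · intro y hy
    rw [Set.mem_iInter] at hy
    obtain ⟨u, hu⟩ := (𝓝 y).exists_antitone_basis
    have hx : ∀ k, ∃ x ∈ (T k).1, f x ∈ u k := fun k => by
      obtain ⟨_, h1, ⟨x, hx, rfl⟩⟩ := mem_closure_iff_nhds.1 (hy k) _ (hu.1.mem_of_mem trivial)
      exact ⟨x, hx, h1⟩
    choose x hxT hxu using hx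
    have hcomp : IsCompact (Set.univ.pi fun i => Set.Iic (n i + ∑ k ∈ Finset.range (i + 1), x k i)) :=
      isCompact_univ_pi fun i => (Set.finite_Iic _).isCompact
    have hmem : ∀ k, x k ∈ Set.univ.pi fun i =>
        Set.Iic (n i + ∑ k ∈ Finset.range (i + 1), x k i) := by
      intro k i _
      rcases lt_or_ge i k with h | h
      · exact (hTle k i h _ (hxT k)).trans (Nat.le_add_right _ _)
      · exact (Finset.single_le_sum (f := fun k => x k i) (fun _ _ => Nat.zero_le _)
          (Finset.mem_range.2 (Nat.lt_succ_of_le h))).trans (Nat.le_add_left _ _)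
    obtain ⟨a, -, φ, hφ, hlim⟩ := hcomp.tendsto_subseq hmem
    exact ⟨a, tendsto_nhds_unique ((hf.tendsto a).comp hlim)
      ((hu.tendsto hxu).comp hφ.tendsto_atTop)⟩
  · have hanti' : Antitone fun k => closure (f '' (T k).1) := fun a b hab =>
      closure_mono (Set.image_mono (hanti hab))
    rw [hanti'.measure_iInter (fun k => isClosed_closure.measurableSet.nullMeasurableSet)
      ⟨0, measure_ne_top _ _⟩]
    exact le_iInf fun k => (T k).2.le.trans (measure_mono subset_closure)

/-- Analytic sets are universally measurable. -/
lemma MeasureTheory.AnalyticSet.nullMeasurableSet {Z : Type*} [TopologicalSpace Z] [T2Space Z]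
    [FirstCountableTopology Z] [MeasurableSpace Z] [OpensMeasurableSpace Z]
    {ρ : Measure Z} [IsFiniteMeasure ρ] {s : Set Z} (hs : AnalyticSet s) :
    NullMeasurableSet s ρ := by
  rw [AnalyticSet] at hs
  obtain rfl | ⟨f, hf, rfl⟩ := hs
  · exact .empty
  rcases eq_or_ne (ρ (Set.range f)) 0 with h0 | h0
  · exact .of_null h0
  obtain ⟨u, -, hu, hlim⟩ := exists_seq_strictMono_tendsto' (bot_lt_iff_ne_bot.2 h0)
  choose K hK hKm hKu using fun n =>
    exists_measurableSet_subset_range_of_lt_measure (ρ := ρ) hf (hu n).2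
  have hKU : MeasurableSet (⋃ n, K n) := .iUnion hKm
  refine hKU.nullMeasurableSet.congr (ae_eq_of_subset_of_measure_ge (Set.iUnion_subset hK) ?_
    hKU.nullMeasurableSet (measure_ne_top _ _))
  exact le_of_tendsto' hlim fun n => (hKu n).trans (measure_mono (Set.subset_iUnion _ _))

/-- The set of sequences extending a given finite list. -/
def listCylinder (l : List ℕ) : Set (ℕ → ℕ) := {x | (List.range l.length).map x = l}

/-- The leftmost branch through the fibre of `f` over `z`, as its sequence of initial segments. -/
noncomputable def leftmostPrefix {Z : Type*} (f : (ℕ → ℕ) → Z) (z : Z) : ℕ → List ℕ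
  | 0 => []
  | k + 1 => leftmostPrefix f z k ++
      [sInf {n | z ∈ f '' listCylinder (leftmostPrefix f z k ++ [n])}]

lemma length_leftmostPrefix {Z : Type*} (f : (ℕ → ℕ) → Z) (z : Z) (k : ℕ) :
    (leftmostPrefix f z k).length = k := by
  induction k with
  | zero => rfl
  | succ k ih => simp [leftmostPrefix, ih]

/-- The leftmost point of the fibre of `f` over `z`. -/
noncomputable def leftmostBranch {Z : Type*} (f : (ℕ → ℕ) → Z) (z : Z) (k : ℕ) : ℕ :=
  sInf {n | z ∈ f '' listCylinder (leftmostPrefix f z k ++ [n])}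

lemma map_leftmostBranch_range {Z : Type*} (f : (ℕ → ℕ) → Z) (z : Z) (k : ℕ) :
    (List.range k).map (leftmostBranch f z) = leftmostPrefix f z k := by
  induction k with
  | zero => rfl
  | succ k ih => simp [List.range_succ, ih, leftmostPrefix, leftmostBranch]

lemma mem_image_listCylinder_leftmostPrefix {Z : Type*} {f : (ℕ → ℕ) → Z} {z : Z}
    (hz : z ∈ Set.range f) (k : ℕ) : z ∈ f '' listCylinder (leftmostPrefix f z k) := by
  induction k with
  | zero => simpa [listCylinder, leftmostPrefix] using hz
  | succ k ih =>
    obtain ⟨x, hx, rfl⟩ := ih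
    refine Nat.sInf_mem (s := {n | f x ∈ f '' listCylinder (leftmostPrefix f (f x) k ++ [n])})
      ⟨x k, x, ?_, rfl⟩
    simp only [listCylinder, length_leftmostPrefix, Set.mem_ofPred_eq, List.length_append,
      List.length_singleton, List.range_succ, List.map_append, List.map_cons, List.map_nil] at hx ⊢
    rw [hx]

lemma apply_leftmostBranch {Z : Type*} [TopologicalSpace Z] [T2Space Z] {f : (ℕ → ℕ) → Z}
    (hf : Continuous f) {z : Z} (hz : z ∈ Set.range f) : f (leftmostBranch f z) = z := by
  choose x hx hxz using mem_image_listCylinder_leftmostPrefix hz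
  have hlim : Filter.Tendsto x Filter.atTop (𝓝 (leftmostBranch f z)) := by
    rw [tendsto_pi_nhds]
    intro i
    refine tendsto_const_nhds.congr' ?_
    filter_upwards [Filter.eventually_gt_atTop i] with k hk
    have h := hx k
    rw [listCylinder, Set.mem_ofPred_eq, length_leftmostPrefix, ← map_leftmostBranch_range] at h
    exact (List.map_inj_left.1 h i (List.mem_range.2 hk)).symm
  refine tendsto_nhds_unique ((hf.tendsto _).comp hlim) ?_
  simp [Function.comp_def, hxz]

lemma nullMeasurableSet_sInf_eq {Z : Type*} [MeasurableSpace Z] {ρ : Measure Z} {A : ℕ → Set Z}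
    (hA : ∀ n, NullMeasurableSet (A n) ρ) (n : ℕ) :
    NullMeasurableSet {z | sInf {m | z ∈ A m} = n} ρ := by
  have h : ∀ n, NullMeasurableSet (A n ∩ ⋂ m, ⋂ (_ : m < n), (A m)ᶜ) ρ := fun n =>
    (hA n).inter (.iInter fun m => .iInter fun _ => (hA m).compl)
  have heq : ∀ n z, z ∈ (A n ∩ ⋂ m, ⋂ (_ : m < n), (A m)ᶜ) ↔ z ∈ A n ∧ ∀ m < n, z ∉ A m := by
    simp
  rcases Nat.eq_zero_or_pos n with rfl | hn
  · convert (h 0).union (NullMeasurableSet.iInter fun m => (hA m).compl) using 1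
    ext z
    simp [Nat.sInf_eq_zero, Set.eq_empty_iff_forall_notMem]
  · convert h n using 1
    ext z
    rw [heq]
    constructor
    · rintro rfl
      exact ⟨Nat.sInf_mem (Nat.nonempty_of_pos_sInf hn), fun m hm => Nat.notMem_of_lt_sInf hm⟩
    · rintro ⟨h1, h2⟩
      refine le_antisymm (Nat.sInf_le h1) (le_of_not_gt fun hlt => ?_)
      exact h2 _ hlt (Nat.sInf_mem (s := {m | z ∈ A m}) ⟨n, h1⟩)

lemma isClosed_listCylinder (l : List ℕ) : IsClosed (listCylinder l) := by
  have : listCylinder l = ⋂ i : Fin l.length, {x : ℕ → ℕ | x i = l[i]} := by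
    ext x
    simp only [listCylinder, Set.mem_ofPred_eq, Set.mem_iInter]
    rw [List.ext_getElem_iff]
    simp [Fin.forall_iff]
  rw [this]
  exact isClosed_iInter fun i => isClosed_eq (continuous_apply _) continuous_const

lemma aemeasurable_leftmostBranch {Z : Type*} [TopologicalSpace Z] [T2Space Z]
    [FirstCountableTopology Z] [MeasurableSpace Z] [OpensMeasurableSpace Z]
    {ρ : Measure Z} [IsFiniteMeasure ρ] {f : (ℕ → ℕ) → Z} (hf : Continuous f) :
    AEMeasurable (leftmostBranch f) ρ := by
  have hcyl : ∀ l n, NullMeasurableSet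
      {z | sInf {m | z ∈ f '' listCylinder (l ++ [m])} = n} ρ := fun l n =>
    nullMeasurableSet_sInf_eq (fun m =>
      ((isClosed_listCylinder _).analyticSet.image_of_continuous hf).nullMeasurableSet) n
  have hbranch : ∀ k, (∀ l, NullMeasurableSet {z | leftmostPrefix f z k = l} ρ) →
      ∀ l n, NullMeasurableSet {z | leftmostPrefix f z k = l ∧ leftmostBranch f z k = n} ρ := by
    intro k hk l n
    convert (hk l).inter (hcyl l n) using 1
    ext z
    simp only [leftmostBranch, Set.mem_ofPred_eq, Set.mem_inter_iff]
    constructor <;> rintro ⟨rfl, h⟩ <;> exact ⟨rfl, h⟩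
  have hprefix : ∀ k l, NullMeasurableSet {z | leftmostPrefix f z k = l} ρ := by
    intro k
    induction k with
    | zero => intro l; simp [leftmostPrefix]
    | succ k ih =>
      intro l
      have : {z | leftmostPrefix f z (k + 1) = l} = ⋃ l', ⋃ n, ⋃ (_ : l' ++ [n] = l),
          {z | leftmostPrefix f z k = l' ∧ leftmostBranch f z k = n} := by
        ext z
        simp [leftmostPrefix, leftmostBranch]
      rw [this]
      exact .iUnion fun l' => .iUnion fun n => .iUnion fun _ => hbranch k ih l' n
  refine aemeasurable_pi_iff.2 fun k => NullMeasurable.aemeasurable fun s _ => ?_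
  have : (fun z => leftmostBranch f z k) ⁻¹' s = ⋃ l, ⋃ n, ⋃ (_ : n ∈ s),
      {z | leftmostPrefix f z k = l ∧ leftmostBranch f z k = n} := by
    ext z
    simp
  rw [this]
  exact .iUnion fun l => .iUnion fun n => .iUnion fun _ => hbranch k (hprefix k) l n

/-- Universal measurability of projections of measurable sets, with almost everywhere measurable
uniformization (Jankov–von Neumann). -/
theorem exists_measurable_uniformization {Z Θ : Type*} [MeasurableSpace Z] [StandardBorelSpace Z]
    [MeasurableSpace Θ] [StandardBorelSpace Θ] [Nonempty Θ] (ρ : Measure Z) [IsFiniteMeasure ρ]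
    {E : Set (Z × Θ)} (hE : MeasurableSet E) :
    NullMeasurableSet (Prod.fst '' E) ρ ∧
      ∃ g : Z → Θ, Measurable g ∧ ∀ᵐ z ∂ρ, z ∈ Prod.fst '' E → (z, g z) ∈ E := by
  let := upgradeStandardBorel Z
  let := upgradeStandardBorel Θ
  have hA := hE.analyticSet
  refine ⟨(hA.image_of_continuous continuous_fst).nullMeasurableSet, ?_⟩
  rw [AnalyticSet] at hA
  obtain rfl | ⟨f, hf, rfl⟩ := hA
  · exact ⟨fun _ => Classical.arbitrary Θ, measurable_const, by simp⟩
  have hcont : Continuous (Prod.fst ∘ f) := continuous_fst.comp hf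
  have hae := aemeasurable_leftmostBranch (ρ := ρ) hcont
  refine ⟨fun z => (f (hae.mk _ z)).2, (measurable_snd.comp hf.measurable).comp hae.measurable_mk, ?_⟩
  filter_upwards [hae.ae_eq_mk] with z hz hmem
  rw [← Set.range_comp] at hmem
  have h := apply_leftmostBranch hcont hmem
  rw [← hz]
  exact ⟨_, Prod.ext h rfl⟩

/-- A Markov kernel from a Polish space that takes every probability measure as a value. -/
lemma exists_isMarkovKernel_forall_exists_eq (S : Type*) [MeasurableSpace S] [StandardBorelSpace S]
    [Nonempty S] : ∃ K : Kernel (ℚ → ℝ) S, IsMarkovKernel K ∧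
      ∀ π : Measure S, IsProbabilityMeasure π → ∃ θ, K θ = π := by
  have he := measurableEmbedding_embeddingReal S
  let K₀ : Kernel (ℚ → ℝ) ℝ :=
    ⟨_, measurable_measure_stieltjesOfMeasurableRat (f := (id : (ℚ → ℝ) → ℚ → ℝ)) measurable_id⟩
  have hK₀ : IsMarkovKernel K₀ :=
    ⟨fun θ => instIsProbabilityMeasure_stieltjesOfMeasurableRat measurable_id θ⟩
  refine ⟨K₀.map he.invFun, Kernel.IsMarkovKernel.map _ he.measurable_invFun, fun π hπ => ?_⟩
  have hπ' : IsProbabilityMeasure (π.map (embeddingReal S)) :=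
    Measure.isProbabilityMeasure_map he.measurable.aemeasurable
  let F := cdf (π.map (embeddingReal S))
  have hF : IsRatStieltjesPoint (id : (ℚ → ℝ) → ℚ → ℝ) fun q : ℚ => F q :=
    { mono := fun a b hab => F.mono (Rat.cast_le.2 hab)
      tendsto_atTop_one := (tendsto_cdf_atTop _).comp (tendsto_ratCast_atTop_iff.2 Filter.tendsto_id)
      tendsto_atBot_zero := (tendsto_cdf_atBot _).comp (tendsto_ratCast_atBot_iff.2 Filter.tendsto_id)
      iInf_rat_gt_eq := fun t => by
        rw [id, ← F.iInf_rat_gt_eq t]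
        exact (Equiv.subtypeEquivRight fun r => by simp).iInf_congr fun r => rfl }
  have hK : K₀ (fun q : ℚ => F q) = π.map (embeddingReal S) := by
    refine ext_of_generate_finite _ ?_ Real.isPiSystem_Iic_rat ?_ ?_
    · exact (BorelSpace.measurable_eq (α := ℝ)).trans Real.borel_eq_generateFrom_Iic_rat
    · intro s hs
      simp only [Set.mem_iUnion, Set.mem_singleton_iff] at hs
      obtain ⟨q, rfl⟩ := hs
      refine (measure_stieltjesOfMeasurableRat_Iic measurable_id _ _).trans ?_
      rw [stieltjesOfMeasurableRat_eq, toRatCDF_of_isRatStieltjesPoint hF]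
      exact ofReal_cdf _ _
    · simp
  refine ⟨fun q : ℚ => F q, ?_⟩
  rw [Kernel.map_apply _ he.measurable_invFun, hK, Measure.map_map he.measurable_invFun he.measurable,
    he.leftInverse_invFun.comp_eq_id, Measure.map_id]

lemma measurableSet_kernel_eq {Z S : Type*} [MeasurableSpace Z] [MeasurableSpace S]
    [StandardBorelSpace S] (κ η : Kernel Z S) [IsMarkovKernel κ] [IsMarkovKernel η] :
    MeasurableSet {z | κ z = η z} := by
  have he := measurableEmbedding_embeddingReal S
  have : {z | κ z = η z} = ⋂ q : ℚ, {z | κ z (embeddingReal S ⁻¹' Set.Iic (q : ℝ)) =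
      η z (embeddingReal S ⁻¹' Set.Iic (q : ℝ))} := by
    ext z
    simp only [Set.mem_ofPred_eq, Set.mem_iInter]
    refine ⟨fun h q => by rw [h], fun h => ?_⟩
    have hmap : (κ z).map (embeddingReal S) = (η z).map (embeddingReal S) := by
      refine ext_of_generate_finite _ ?_ Real.isPiSystem_Iic_rat ?_ ?_
      · exact (BorelSpace.measurable_eq (α := ℝ)).trans Real.borel_eq_generateFrom_Iic_rat
      · intro s hs
        simp only [Set.mem_iUnion, Set.mem_singleton_iff] at hs
        obtain ⟨q, rfl⟩ := hs
        rw [Measure.map_apply he.measurable measurableSet_Iic,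
          Measure.map_apply he.measurable measurableSet_Iic, h q]
      · rw [Measure.map_apply he.measurable .univ, Measure.map_apply he.measurable .univ]
        simp
    rw [← he.comap_map (κ z), hmap, he.comap_map]
  rw [this]
  exact .iInter fun q => measurableSet_eq_fun
    (κ.measurable_coe (he.measurable measurableSet_Iic))
    (η.measurable_coe (he.measurable measurableSet_Iic))

lemma IsCoupling.isProbabilityMeasure {A B : Type*} [MeasurableSpace A] [MeasurableSpace B]
    {γ : Measure (A × B)} {μ : Measure A} {ν : Measure B} [IsProbabilityMeasure μ]
    (h : IsCoupling γ μ ν) : IsProbabilityMeasure γ := by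
  have hμ : IsProbabilityMeasure (γ.map Prod.fst) := by rw [h.1]; infer_instance
  exact Measure.isProbabilityMeasure_of_map Prod.fst

lemma isCoupling_prod {A B : Type*} [MeasurableSpace A] [MeasurableSpace B]
    (μ : Measure A) (ν : Measure B) [IsProbabilityMeasure μ] [IsProbabilityMeasure ν] :
    IsCoupling (μ.prod ν) μ ν := by
  constructor <;> simp

/-- Measurable selection of couplings: couplings whose cost satisfies a measurable condition can be
chosen measurably wherever they exist. -/
theorem exists_kernel_isCoupling {Z A B : Type*} [MeasurableSpace Z] [MeasurableSpace A]
    [MeasurableSpace B] [StandardBorelSpace Z] [StandardBorelSpace A] [StandardBorelSpace B]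
    [Nonempty A] [Nonempty B] (ρ : Measure Z) [IsFiniteMeasure ρ]
    (κ₁ : Kernel Z A) (κ₂ : Kernel Z B) [IsMarkovKernel κ₁] [IsMarkovKernel κ₂]
    {F : A × B → ℝ≥0∞} (hF : Measurable F) {P : Set (Z × ℝ≥0∞)} (hP : MeasurableSet P) :
    NullMeasurableSet {z | ∃ π, IsCoupling π (κ₁ z) (κ₂ z) ∧ (z, ∫⁻ x, F x ∂π) ∈ P} ρ ∧
      ∃ η : Kernel Z (A × B), IsMarkovKernel η ∧ ∀ᵐ z ∂ρ, IsCoupling (η z) (κ₁ z) (κ₂ z) ∧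
        ((∃ π, IsCoupling π (κ₁ z) (κ₂ z) ∧ (z, ∫⁻ x, F x ∂π) ∈ P) →
          (z, ∫⁻ x, F x ∂(η z)) ∈ P) := by
  obtain ⟨K, hK, hKsurj⟩ := exists_isMarkovKernel_forall_exists_eq (A × B)
  let E₀ : Set (Z × (ℚ → ℝ)) := {p | IsCoupling (K p.2) (κ₁ p.1) (κ₂ p.1)}
  have hE₀ : MeasurableSet E₀ := by
    have h1 := measurableSet_kernel_eq
      (K.fst.comap (Prod.snd : Z × (ℚ → ℝ) → _) measurable_snd)
      (κ₁.comap (Prod.fst : Z × (ℚ → ℝ) → _) measurable_fst)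
    have h2 := measurableSet_kernel_eq
      (K.snd.comap (Prod.snd : Z × (ℚ → ℝ) → _) measurable_snd)
      (κ₂.comap (Prod.fst : Z × (ℚ → ℝ) → _) measurable_fst)
    convert h1.inter h2 using 1
    ext p
    simp [E₀, IsCoupling, Kernel.fst_apply, Kernel.snd_apply]
  have hcost : Measurable fun p : Z × (ℚ → ℝ) => (p.1, ∫⁻ x, F x ∂(K p.2)) :=
    measurable_fst.prodMk (hF.lintegral_kernel.comp measurable_snd)
  let E : Set (Z × (ℚ → ℝ)) := E₀ ∩ (fun p => (p.1, ∫⁻ x, F x ∂(K p.2))) ⁻¹' P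
  have hE : MeasurableSet E := hE₀.inter (hcost hP)
  have hproj : Prod.fst '' E = {z | ∃ π, IsCoupling π (κ₁ z) (κ₂ z) ∧ (z, ∫⁻ x, F x ∂π) ∈ P} := by
    ext z
    constructor
    · rintro ⟨⟨z, θ⟩, ⟨h1, h2⟩, rfl⟩
      exact ⟨K θ, h1, h2⟩
    · rintro ⟨π, h1, h2⟩
      obtain ⟨θ, rfl⟩ := hKsurj π h1.isProbabilityMeasure
      exact ⟨(z, θ), ⟨h1, h2⟩, rfl⟩
  obtain ⟨-, g₀, hg₀m, hg₀⟩ := exists_measurable_uniformization ρ hE₀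
  obtain ⟨hD, g, hgm, hg⟩ := exists_measurable_uniformization ρ hE
  rw [hproj] at hD hg
  refine ⟨hD, ?_⟩
  obtain ⟨D, hDm, hDeq⟩ := hD
  classical
  have hθ : Measurable (D.piecewise g g₀) := hgm.piecewise hDm hg₀m
  refine ⟨K.comap _ hθ, inferInstance, ?_⟩
  filter_upwards [hg₀, hg, hDeq.mem_iff] with z h₀ h hz
  rw [Kernel.comap_apply]
  by_cases hmem : z ∈ D
  · rw [Set.piecewise_eq_of_mem _ _ _ hmem]
    have := h (hz.2 hmem)
    exact ⟨this.1, fun _ => this.2⟩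
  · rw [Set.piecewise_eq_of_notMem _ _ _ hmem]
    refine ⟨h₀ ?_, fun hex => absurd (hz.1 hex) hmem⟩
    obtain ⟨θ, hθ⟩ := hKsurj ((κ₁ z).prod (κ₂ z)) inferInstance
    exact ⟨(z, θ), by simpa [E₀, hθ] using isCoupling_prod (κ₁ z) (κ₂ z), rfl⟩

/-- The optimal transport cost with values in `ℝ≥0∞`. -/
noncomputable def transportCost {A B : Type*} [MeasurableSpace A] [MeasurableSpace B]
    (F : A × B → ℝ≥0∞) (μ : Measure A) (ν : Measure B) : ℝ≥0∞ :=
  ⨅ π : {π : Measure (A × B) // IsCoupling π μ ν}, ∫⁻ x, F x ∂π.1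

lemma transportCost_le {A B : Type*} [MeasurableSpace A] [MeasurableSpace B]
    (F : A × B → ℝ≥0∞) {μ : Measure A} {ν : Measure B} {π : Measure (A × B)}
    (hπ : IsCoupling π μ ν) : transportCost F μ ν ≤ ∫⁻ x, F x ∂π :=
  iInf_le (fun π : {π : Measure (A × B) // IsCoupling π μ ν} => ∫⁻ x, F x ∂π.1) ⟨π, hπ⟩

lemma transportCost_lt_iff {A B : Type*} [MeasurableSpace A] [MeasurableSpace B]
    {F : A × B → ℝ≥0∞} {μ : Measure A} {ν : Measure B} {t : ℝ≥0∞} :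
    transportCost F μ ν < t ↔ ∃ π, IsCoupling π μ ν ∧ ∫⁻ x, F x ∂π < t := by
  simp [transportCost, iInf_lt_iff]

section Kernel

variable {Z A B : Type*} [MeasurableSpace Z] [MeasurableSpace A]
  [MeasurableSpace B] [StandardBorelSpace Z] [StandardBorelSpace A] [StandardBorelSpace B]
  [Nonempty A] [Nonempty B] (ρ : Measure Z) [IsFiniteMeasure ρ]
  (κ₁ : Kernel Z A) (κ₂ : Kernel Z B) [IsMarkovKernel κ₁] [IsMarkovKernel κ₂]
  {F : A × B → ℝ≥0∞}

lemma aemeasurable_transportCost (hF : Measurable F) :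
    AEMeasurable (fun z => transportCost F (κ₁ z) (κ₂ z)) ρ := by
  refine NullMeasurable.aemeasurable (measurable_of_Iio (δ := NullMeasurableSpace Z ρ) fun t => ?_)
  have h := (exists_kernel_isCoupling ρ κ₁ κ₂ hF
    (measurable_snd measurableSet_Iio : MeasurableSet (Prod.snd ⁻¹' Set.Iio t))).1
  have heq : (fun z => transportCost F (κ₁ z) (κ₂ z)) ⁻¹' Set.Iio t =
      {z | ∃ π, IsCoupling π (κ₁ z) (κ₂ z) ∧ (z, ∫⁻ x, F x ∂π) ∈ Prod.snd ⁻¹' Set.Iio t} := by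
    ext z
    exact transportCost_lt_iff
  exact heq ▸ h

lemma exists_kernel_lintegral_le_transportCost_add (hF : Measurable F) {ε : ℝ≥0∞} (hε : ε ≠ 0) :
    ∃ η : Kernel Z (A × B), IsMarkovKernel η ∧ ∀ᵐ z ∂ρ, IsCoupling (η z) (κ₁ z) (κ₂ z) ∧
      ∫⁻ x, F x ∂(η z) ≤ transportCost F (κ₁ z) (κ₂ z) + ε := by
  have hV := aemeasurable_transportCost ρ κ₁ κ₂ hF
  have hP : MeasurableSet {p : Z × ℝ≥0∞ | p.2 ≤ hV.mk _ p.1 + ε} :=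
    measurableSet_le measurable_snd ((hV.measurable_mk.comp measurable_fst).add_const _)
  obtain ⟨-, η, hη, h⟩ := exists_kernel_isCoupling ρ κ₁ κ₂ hF hP
  refine ⟨η, hη, ?_⟩
  filter_upwards [h, hV.ae_eq_mk] with z hz hmk
  refine ⟨hz.1, ?_⟩
  simp only [← hmk] at hz
  rcases eq_or_ne (transportCost F (κ₁ z) (κ₂ z)) ∞ with htop | htop
  · simp [htop]
  · obtain ⟨π, hπ, hlt⟩ := transportCost_lt_iff.1 (ENNReal.lt_add_right htop hε)
    exact hz.2 ⟨π, hπ, hlt.le⟩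

end Kernel

lemma map_compProd_condKernel_eq {X Y Z S : Type*} [MeasurableSpace X] [MeasurableSpace Y]
    [MeasurableSpace Z] [MeasurableSpace S] [StandardBorelSpace X] [Nonempty X]
    (μ : Measure (X × Y)) [IsFiniteMeasure μ] (ρ : Measure Z) [SFinite ρ] (η : Kernel Z S)
    [IsSFiniteKernel η] {p : Z → Y} {r : S → X} (hp : Measurable p) (hr : Measurable r)
    (hρ : ρ.map p = μ.map Prod.snd)
    (hη : ∀ᵐ z ∂ρ, (η z).map r = (μ.map Prod.swap).condKernel (p z)) :
    (ρ ⊗ₘ η).map (fun q => (r q.2, p q.1)) = μ := by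
  ext s hs
  have hs' : MeasurableSet (Prod.swap ⁻¹' s : Set (Y × X)) := measurable_swap hs
  have hfst : (μ.map Prod.swap).fst = μ.map Prod.snd := by
    rw [Measure.fst, Measure.map_map measurable_fst measurable_swap]
    rfl
  have hm : Measurable fun q : Z × S => (r q.2, p q.1) := by fun_prop
  rw [Measure.map_apply hm hs, Measure.compProd_apply (hm hs)]
  calc ∫⁻ z, η z (Prod.mk z ⁻¹' ((fun q : Z × S => (r q.2, p q.1)) ⁻¹' s)) ∂ρ
      = ∫⁻ z, (μ.map Prod.swap).condKernel (p z) (Prod.mk (p z) ⁻¹' (Prod.swap ⁻¹' s)) ∂ρ := by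
        refine lintegral_congr_ae ?_
        filter_upwards [hη] with z hz
        rw [← hz, Measure.map_apply hr (measurable_prodMk_left hs')]
        rfl
    _ = ∫⁻ y, (μ.map Prod.swap).condKernel y (Prod.mk y ⁻¹' (Prod.swap ⁻¹' s))
          ∂(ρ.map p) := by
        rw [lintegral_map (Kernel.measurable_kernel_prodMk_left hs') hp]
    _ = μ.map Prod.swap (Prod.swap ⁻¹' s) := by
        rw [hρ, ← hfst, ← Measure.compProd_apply hs', Measure.disintegrate]
    _ = μ s := by
        rw [Measure.map_apply measurable_swap hs']
        rfl

/-- Gluing conditional couplings along a coupling of the second marginals. -/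
lemma IsCoupling.glue {X Y : Type*} [MeasurableSpace X] [MeasurableSpace Y]
    [StandardBorelSpace X] [Nonempty X] {μ ν : Measure (X × Y)} [IsFiniteMeasure μ]
    [IsFiniteMeasure ν] {γ : Measure (Y × Y)} [SFinite γ]
    (hγ : IsCoupling γ (μ.map Prod.snd) (ν.map Prod.snd))
    {η : Kernel (Y × Y) (X × X)} [IsSFiniteKernel η]
    (hη : ∀ᵐ z ∂γ, IsCoupling (η z) ((μ.map Prod.swap).condKernel z.1)
      ((ν.map Prod.swap).condKernel z.2)) :
    IsCoupling ((γ ⊗ₘ η).map fun q => ((q.2.1, q.1.1), (q.2.2, q.1.2))) μ ν := by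
  have hm : Measurable fun q : (Y × Y) × (X × X) => ((q.2.1, q.1.1), (q.2.2, q.1.2)) := by fun_prop
  constructor
  · rw [Measure.map_map measurable_fst hm]
    exact map_compProd_condKernel_eq μ γ η measurable_fst measurable_fst hγ.1 (hη.mono fun z h => h.1)
  · rw [Measure.map_map measurable_snd hm]
    exact map_compProd_condKernel_eq ν γ η measurable_snd measurable_snd hγ.2 (hη.mono fun z h => h.2)

section Wass

variable {A B : Type*} [MeasurableSpace A] [MeasurableSpace B] {α : ℝ} {c : A × B → ℝ}
  {μ : Measure A} {ν : Measure B}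

lemma costs_nonneg (hc : ∀ z, 0 ≤ c z) :
    ∀ r ∈ { r | ∃ γ : Measure (A × B), IsCoupling γ μ ν ∧ r = ∫ z, c z ^ α ∂γ }, 0 ≤ r := by
  rintro _ ⟨γ, -, rfl⟩
  exact integral_nonneg fun z => Real.rpow_nonneg (hc z) α

lemma Wass_nonneg (hc : ∀ z, 0 ≤ c z) : 0 ≤ Wass α c μ ν :=
  Real.rpow_nonneg (Real.sInf_nonneg (costs_nonneg hc)) _

lemma Wass_le (hα : 0 ≤ α) (hc : ∀ z, 0 ≤ c z) {γ : Measure (A × B)} (hγ : IsCoupling γ μ ν) :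
    Wass α c μ ν ≤ (∫ z, c z ^ α ∂γ) ^ (1 / α) :=
  Real.rpow_le_rpow (Real.sInf_nonneg (costs_nonneg hc))
    (csInf_le ⟨0, fun _ hr => costs_nonneg hc _ hr⟩ ⟨γ, hγ, rfl⟩) (by positivity)

lemma ofReal_Wass_le (hα : 0 < α) (hc : ∀ z, 0 ≤ c z) (hcm : Measurable c)
    {γ : Measure (A × B)} (hγ : IsCoupling γ μ ν) :
    ENNReal.ofReal (Wass α c μ ν) ≤ (∫⁻ z, ENNReal.ofReal (c z) ^ α ∂γ) ^ (1 / α) := by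
  refine (ENNReal.ofReal_le_ofReal (Wass_le hα.le hc hγ)).trans ?_
  rw [integral_eq_lintegral_of_nonneg_ae (.of_forall fun z => Real.rpow_nonneg (hc z) α)
    (hcm.pow_const α).aestronglyMeasurable, ENNReal.toReal_rpow]
  refine ENNReal.ofReal_toReal_le.trans (le_of_eq ?_)
  simp_rw [ENNReal.ofReal_rpow_of_nonneg (hc _) hα.le]

lemma Wass_rpow_eq_toReal_transportCost (hα : 0 < α) (hc : ∀ z, 0 ≤ c z) (hcm : Measurable c)
    (hfin : ∀ γ, IsCoupling γ μ ν → ∫⁻ z, ENNReal.ofReal (c z) ^ α ∂γ ≠ ∞) :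
    Wass α c μ ν ^ α = (transportCost (fun z => ENNReal.ofReal (c z) ^ α) μ ν).toReal := by
  rw [Wass, ← Real.rpow_mul (Real.sInf_nonneg (costs_nonneg hc)), one_div_mul_cancel hα.ne',
    Real.rpow_one, transportCost, ENNReal.toReal_iInf
      (f := fun π : {π : Measure (A × B) // IsCoupling π μ ν} =>
        ∫⁻ z, ENNReal.ofReal (c z) ^ α ∂π.1) fun π => hfin π.1 π.2, iInf]
  congr 1
  ext r
  have key : ∀ γ : Measure (A × B), (∫⁻ z, ENNReal.ofReal (c z) ^ α ∂γ).toReal =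
      ∫ z, c z ^ α ∂γ := fun γ => by
    rw [integral_eq_lintegral_of_nonneg_ae (.of_forall fun z => Real.rpow_nonneg (hc z) α)
      (hcm.pow_const α).aestronglyMeasurable]
    simp_rw [ENNReal.ofReal_rpow_of_nonneg (hc _) hα.le]
  simp [key, eq_comm]

lemma Wass_eq_zero_of_not_integrable (hα : 0 < α) (hc : ∀ z, 0 ≤ c z) {γ : Measure (A × B)}
    (hγ : IsCoupling γ μ ν) (hint : ¬ Integrable (fun z => c z ^ α) γ) : Wass α c μ ν = 0 := by
  refine le_antisymm ((Wass_le hα.le hc hγ).trans_eq ?_) (Wass_nonneg hc)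
  rw [integral_undef hint, Real.zero_rpow (by positivity)]

end Wass

theorem statement4 {X Y : Type*} [MeasurableSpace X] [MeasurableSpace Y]
    [StandardBorelSpace X] [StandardBorelSpace Y] [Nonempty X]
    (c₁ : X × X → ℝ) (c₂ : Y × Y → ℝ)
    (hc₁meas : Measurable c₁) (hc₂meas : Measurable c₂)
    (hc₁nonneg : ∀ z, 0 ≤ c₁ z) (hc₂nonneg : ∀ z, 0 ≤ c₂ z)
    (μ ν : Measure (X × Y)) [IsProbabilityMeasure μ] [IsProbabilityMeasure ν]
    (α : ℝ) (hα : 1 ≤ α)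
    (γy : Measure (Y × Y)) (hγy : IsCoupling γy (μ.map Prod.snd) (ν.map Prod.snd))
    (hγyopt : (∫ z, c₂ z ^ α ∂γy) ^ (1 / α) =
      Wass α c₂ (μ.map Prod.snd) (ν.map Prod.snd)) :
    Wass α (fun z : (X × Y) × (X × Y) => c₁ (z.1.1, z.2.1) + c₂ (z.1.2, z.2.2)) μ ν ≤
      Wass α c₂ (μ.map Prod.snd) (ν.map Prod.snd) +
        (∫ z, Wass α c₁ ((μ.map Prod.swap).condKernel z.1)
          ((ν.map Prod.swap).condKernel z.2) ^ α ∂γy) ^ (1 / α) := by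
  have hα0 : 0 < α := one_pos.trans_le hα
  set c : (X × Y) × (X × Y) → ℝ := fun z => c₁ (z.1.1, z.2.1) + c₂ (z.1.2, z.2.2)
  have hc : ∀ z, 0 ≤ c z := fun z => add_nonneg (hc₁nonneg _) (hc₂nonneg _)
  have hcm : Measurable c := by fun_prop
  by_cases hint : ∀ γ, IsCoupling γ μ ν → Integrable (fun z => c z ^ α) γ
  swap
  · push Not at hint
    obtain ⟨γ, hγ, hγint⟩ := hint
    rw [Wass_eq_zero_of_not_integrable hα0 hc hγ hγint]
    exact add_nonneg (Wass_nonneg hc₂nonneg) (Real.rpow_nonneg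
      (integral_nonneg fun z => Real.rpow_nonneg (Wass_nonneg hc₁nonneg) _) _)
  have hprob : IsProbabilityMeasure (μ.map Prod.snd) :=
    Measure.isProbabilityMeasure_map measurable_snd.aemeasurable
  have hγprob : IsProbabilityMeasure γy := hγy.isProbabilityMeasure
  let κ₁ : Kernel (Y × Y) X := (μ.map Prod.swap).condKernel.comap Prod.fst measurable_fst
  let κ₂ : Kernel (Y × Y) X := (ν.map Prod.swap).condKernel.comap Prod.snd measurable_snd
  let F : X × X → ℝ≥0∞ := fun x => ENNReal.ofReal (c₁ x) ^ α
  have hF : Measurable F := by fun_prop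
  let H : Y × Y → ℝ≥0∞ := fun y => ENNReal.ofReal (c₂ y) ^ α
  have hH : Measurable H := by fun_prop
  let glue : (Y × Y) × (X × X) → (X × Y) × (X × Y) := fun q => ((q.2.1, q.1.1), (q.2.2, q.1.2))
  have hglue : Measurable glue := by fun_prop
  have hcost : ∀ η : Kernel (Y × Y) (X × X), IsMarkovKernel η →
      (∀ᵐ z ∂γy, IsCoupling (η z) (κ₁ z) (κ₂ z)) →
      (∫⁻ z, ∫⁻ x, F x ∂(η z) ∂γy ≠ ∞ ∧ ∫⁻ z, H z ∂γy ≠ ∞) ∧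
      ENNReal.ofReal (Wass α c μ ν) ≤
        (∫⁻ z, ∫⁻ x, F x ∂(η z) ∂γy) ^ (1 / α) + (∫⁻ z, H z ∂γy) ^ (1 / α) := by
    intro η hη hcoup
    have hG := hγy.glue hcoup
    have hF' : ∫⁻ q, F q.2 ∂(γy ⊗ₘ η) = ∫⁻ z, ∫⁻ x, F x ∂(η z) ∂γy :=
      Measure.lintegral_compProd (hF.comp measurable_snd)
    have hH' : ∫⁻ q, H q.1 ∂(γy ⊗ₘ η) = ∫⁻ z, H z ∂γy := by
      rw [Measure.lintegral_compProd (f := fun q => H q.1) (hH.comp measurable_fst)]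
      simp
    have hcG : ∫⁻ z, ENNReal.ofReal (c z) ^ α ∂((γy ⊗ₘ η).map glue) =
        ∫⁻ q, ENNReal.ofReal (c (glue q)) ^ α ∂(γy ⊗ₘ η) :=
      lintegral_map (by fun_prop) hglue
    have hfin : ∫⁻ q, ENNReal.ofReal (c (glue q)) ^ α ∂(γy ⊗ₘ η) ≠ ∞ := by
      rw [← hcG]
      have h := (hint _ hG).lintegral_lt_top.ne
      simpa only [ENNReal.ofReal_rpow_of_nonneg (hc _) hα0.le] using h
    refine ⟨⟨?_, ?_⟩, ?_⟩
    · rw [← hF']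
      refine ne_top_of_le_ne_top hfin (lintegral_mono fun q => ?_)
      exact ENNReal.rpow_le_rpow (ENNReal.ofReal_le_ofReal
        (le_add_of_nonneg_right (hc₂nonneg _))) hα0.le
    · rw [← hH']
      refine ne_top_of_le_ne_top hfin (lintegral_mono fun q => ?_)
      exact ENNReal.rpow_le_rpow (ENNReal.ofReal_le_ofReal
        (le_add_of_nonneg_left (hc₁nonneg _))) hα0.le
    · refine (ofReal_Wass_le hα0 hc hcm hG).trans ?_
      rw [hcG, ← hF', ← hH']
      have hadd : ∀ q : (Y × Y) × (X × X), ENNReal.ofReal (c (glue q)) =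
          ((fun q : (Y × Y) × (X × X) => ENNReal.ofReal (c₁ q.2)) +
            fun q : (Y × Y) × (X × X) => ENNReal.ofReal (c₂ q.1)) q := fun q =>
        ENNReal.ofReal_add (hc₁nonneg _) (hc₂nonneg _)
      simp_rw [hadd]
      exact ENNReal.lintegral_Lp_add_le (by fun_prop) (by fun_prop) hα
  have hV := aemeasurable_transportCost γy κ₁ κ₂ hF
  -- Almost every pair of conditional laws only admits couplings of finite cost.
  have hfin : ∀ᵐ z ∂γy, ∀ π, IsCoupling π (κ₁ z) (κ₂ z) → ∫⁻ x, F x ∂π ≠ ∞ := by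
    obtain ⟨-, η, hη, h⟩ := exists_kernel_isCoupling γy κ₁ κ₂ hF
      (measurable_snd (measurableSet_singleton ∞) : MeasurableSet (Prod.snd ⁻¹' {∞}))
    have hlt := ae_lt_top hF.lintegral_kernel (hcost η hη (h.mono fun z hz => hz.1)).1.1
    filter_upwards [h, hlt] with z hz hz' π hπ htop
    exact hz'.ne (hz.2 ⟨π, hπ, htop⟩)
  set I := ∫⁻ z, transportCost F (κ₁ z) (κ₂ z) ∂γy with hI_def
  set J := ∫⁻ z, H z ∂γy with hJ_def
  obtain ⟨hI, hJ⟩ : I ≠ ∞ ∧ J ≠ ∞ := by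
    obtain ⟨η, hη, h⟩ := exists_kernel_lintegral_le_transportCost_add γy κ₁ κ₂ hF one_ne_zero
    have hη' := (hcost η hη (h.mono fun z hz => hz.1)).1
    refine ⟨ne_top_of_le_ne_top hη'.1 (lintegral_mono_ae ?_), hη'.2⟩
    filter_upwards [h] with z hz using transportCost_le F hz.1
  have hWI : ∫ z, Wass α c₁ ((μ.map Prod.swap).condKernel z.1)
      ((ν.map Prod.swap).condKernel z.2) ^ α ∂γy = I.toReal := by
    rw [hI_def, ← integral_toReal hV (ae_lt_top' hV hI)]
    refine integral_congr_ae ?_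
    filter_upwards [hfin] with z hz
    exact Wass_rpow_eq_toReal_transportCost hα0 hc₁nonneg hc₁meas hz
  have hWJ : ∫ z, c₂ z ^ α ∂γy = J.toReal := by
    rw [integral_eq_lintegral_of_nonneg_ae (.of_forall fun z => Real.rpow_nonneg (hc₂nonneg z) α)
      (hc₂meas.pow_const α).aestronglyMeasurable]
    simp_rw [hJ_def, H, ENNReal.ofReal_rpow_of_nonneg (hc₂nonneg _) hα0.le]
  have hmain : ENNReal.ofReal (Wass α c μ ν) ≤ I ^ (1 / α) + J ^ (1 / α) := by
    have hε : ∀ ε : ℝ≥0∞, ε ≠ 0 →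
        ENNReal.ofReal (Wass α c μ ν) ≤ (I + ε) ^ (1 / α) + J ^ (1 / α) := by
      intro ε hε
      obtain ⟨η, hη, h⟩ := exists_kernel_lintegral_le_transportCost_add γy κ₁ κ₂ hF hε
      refine (hcost η hη (h.mono fun z hz => hz.1)).2.trans ?_
      gcongr
      calc ∫⁻ z, ∫⁻ x, F x ∂(η z) ∂γy
          ≤ ∫⁻ z, (transportCost F (κ₁ z) (κ₂ z) + ε) ∂γy :=
            lintegral_mono_ae (h.mono fun z hz => hz.2)
        _ = I + ε := by rw [lintegral_add_right _ measurable_const]; simp [hI_def]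
    have hcont : Continuous fun ε : ℝ≥0∞ => (I + ε) ^ (1 / α) + J ^ (1 / α) :=
      (ENNReal.continuous_rpow_const.comp (continuous_const.add continuous_id)).add
        continuous_const
    have hlim := (hcont.tendsto 0).mono_left (nhdsWithin_le_nhds (s := Set.Ioi 0))
    simp only [add_zero] at hlim
    exact ge_of_tendsto hlim (eventually_mem_nhdsWithin.mono fun ε h => hε ε (ne_of_gt h))
  rw [← hγyopt, hWI, hWJ, ENNReal.toReal_rpow, ENNReal.toReal_rpow, add_comm,
    ← ENNReal.toReal_add (by finiteness) (by finiteness)]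
  exact (ENNReal.ofReal_le_iff_le_toReal (by finiteness)).1 hmain
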